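/- Let f, u : ℝⁿ → ℝ be smooth ℤⁿ-periodic functions and g : ℝⁿ → ℝ twice continuously differentiable. Then ∫_{[0,1]ⁿ} ∇g(∇u)·∇(Δ_f u) dμ = −∫_{[0,1]ⁿ} tr( D²g(∇u) D²u D²u ) dμ − ∫_{[0,1]ⁿ} ∇g(∇u)·(D²f ∇u) dμ, where Δ_f u = Δu − ∇f·∇u. -/

import Mathlib

noncomputable section

open MeasureTheory

variable {n : ℕ}

/-- `i`-th partial derivative. -/
def pderiv1 (u : (Fin n → ℝ) → ℝ) (i : Fin n) (x : Fin n → ℝ) : ℝ :=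
  fderiv ℝ u x (Pi.single i 1)

/-- Gradient. -/
def grad (u : (Fin n → ℝ) → ℝ) (x : Fin n → ℝ) : Fin n → ℝ :=
  fun i => pderiv1 u i x

/-- Hessian matrix. -/
def hess (u : (Fin n → ℝ) → ℝ) (x : Fin n → ℝ) : Matrix (Fin n) (Fin n) ℝ :=
  Matrix.of fun i j => pderiv1 (pderiv1 u j) i x

/-- Laplacian. -/
def lap (u : (Fin n → ℝ) → ℝ) (x : Fin n → ℝ) : ℝ :=
  ∑ i, pderiv1 (pderiv1 u i) i x

/-- Euclidean dot product. -/
def dot (a b : Fin n → ℝ) : ℝ := ∑ i, a i * b i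

/-- ℤⁿ-periodicity. -/
def ZPeriodic (u : (Fin n → ℝ) → ℝ) : Prop :=
  ∀ (x : Fin n → ℝ) (k : Fin n → ℤ), u (x + fun i => (k i : ℝ)) = u x

/-- Area element `Q(p) = √(1+|p|²)`. -/
def Qe (p : Fin n → ℝ) : ℝ := Real.sqrt (1 + ∑ i, p i ^ 2)

/-- `v(p) = p / √(1+|p|²)`. -/
def vv (p : Fin n → ℝ) : Fin n → ℝ := fun i => p i / Qe p

/-- Divergence of a vector field. -/
def dvg (V : (Fin n → ℝ) → (Fin n → ℝ)) (x : Fin n → ℝ) : ℝ :=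
  ∑ i, fderiv ℝ (fun y => V y i) x (Pi.single i 1)

/-- Weighted divergence `div_f V = div V − ∇f·V`. -/
def divf (f : (Fin n → ℝ) → ℝ) (V : (Fin n → ℝ) → (Fin n → ℝ)) (x : Fin n → ℝ) : ℝ :=
  dvg V x - dot (grad f x) (V x)

/-- Frobenius inner product of matrices. -/
def frob (A B : Matrix (Fin n) (Fin n) ℝ) : ℝ := ∑ i, ∑ j, A i j * B i j

lemma zperiodic_pderiv1 {u : (Fin n → ℝ) → ℝ} (hu : ZPeriodic u) (i : Fin n) :
    ZPeriodic (pderiv1 u i) := by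
  intro x k
  have h : (fun y => u (y + fun i => (k i : ℝ))) = u := funext fun y => hu y k
  unfold pderiv1
  rw [← fderiv_comp_add_right, h]

lemma contDiff_pderiv1 {u : (Fin n → ℝ) → ℝ} {k m : WithTop ℕ∞} (hu : ContDiff ℝ k u)
    (hmk : m + 1 ≤ k) (i : Fin n) : ContDiff ℝ m (pderiv1 u i) :=
  (hu.fderiv_right hmk).clm_apply contDiff_const

lemma contDiff_top_pderiv1 {u : (Fin n → ℝ) → ℝ} (hu : ContDiff ℝ (⊤ : ℕ∞) u) (i : Fin n) :
    ContDiff ℝ (⊤ : ℕ∞) (pderiv1 u i) :=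
  contDiff_pderiv1 hu (by simp) i

lemma contDiff_grad {u : (Fin n → ℝ) → ℝ} (hu : ContDiff ℝ (⊤ : ℕ∞) u) :
    ContDiff ℝ (⊤ : ℕ∞) (grad u) :=
  contDiff_pi.2 fun i => contDiff_top_pderiv1 hu i

lemma pderiv1_comm {u : (Fin n → ℝ) → ℝ} (hu : ContDiff ℝ 2 u) (i j : Fin n) :
    pderiv1 (pderiv1 u i) j = pderiv1 (pderiv1 u j) i := by
  have hd : Differentiable ℝ (fderiv ℝ u) :=
    (hu.fderiv_right (m := 1) (by norm_num)).differentiable (by norm_num)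
  have key (i j : Fin n) (x : Fin n → ℝ) : pderiv1 (pderiv1 u i) j x =
      fderiv ℝ (fderiv ℝ u) x (Pi.single j 1) (Pi.single i 1) := by
    change fderiv ℝ (fun y => fderiv ℝ u y (Pi.single i 1)) x (Pi.single j 1) = _
    rw [fderiv_clm_apply (hd x) (differentiableAt_const _)]
    simp
  funext x
  rw [key, key]
  exact (hu.contDiffAt.isSymmSndFDerivAt (by simp)) _ _

lemma pderiv1_mul {a b : (Fin n → ℝ) → ℝ} (ha : Differentiable ℝ a) (hb : Differentiable ℝ b)
    (i : Fin n) (x : Fin n → ℝ) :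
    pderiv1 (fun y => a y * b y) i x = a x * pderiv1 b i x + pderiv1 a i x * b x := by
  simp only [pderiv1, fderiv_fun_mul (ha x) (hb x)]
  simp [mul_comm]

lemma pderiv1_sub {a b : (Fin n → ℝ) → ℝ} (ha : Differentiable ℝ a) (hb : Differentiable ℝ b)
    (i : Fin n) (x : Fin n → ℝ) :
    pderiv1 (fun y => a y - b y) i x = pderiv1 a i x - pderiv1 b i x := by
  simp [pderiv1, fderiv_fun_sub (ha x) (hb x)]

lemma pderiv1_sum {ι : Type*} (s : Finset ι) {a : ι → (Fin n → ℝ) → ℝ}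
    (ha : ∀ j, Differentiable ℝ (a j)) (i : Fin n) (x : Fin n → ℝ) :
    pderiv1 (fun y => ∑ j ∈ s, a j y) i x = ∑ j ∈ s, pderiv1 (a j) i x := by
  simp [pderiv1, fderiv_fun_sum fun j _ => ha j x]

lemma pderiv1_exp_neg {f : (Fin n → ℝ) → ℝ} (hf : Differentiable ℝ f) (i : Fin n)
    (x : Fin n → ℝ) :
    pderiv1 (fun y => Real.exp (-f y)) i x = -(Real.exp (-f x) * pderiv1 f i x) := by
  have h := (hf x).hasFDerivAt.neg.exp.fderiv
  simp only [pderiv1]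
  erw [h]
  simp

lemma pderiv1_comp_grad {G u : (Fin n → ℝ) → ℝ} (hG : Differentiable ℝ G)
    (hu : ContDiff ℝ (⊤ : ℕ∞) u) (i : Fin n) (x : Fin n → ℝ) :
    pderiv1 (fun y => G (grad u y)) i x =
      ∑ k, pderiv1 G k (grad u x) * pderiv1 (pderiv1 u k) i x := by
  have hd (k : Fin n) : DifferentiableAt ℝ (pderiv1 u k) x :=
    (contDiff_top_pderiv1 hu k).differentiable (by simp) x
  have hgrad : HasFDerivAt (grad u)
      (ContinuousLinearMap.pi fun k => fderiv ℝ (pderiv1 u k) x) x :=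
    hasFDerivAt_pi.2 fun k => (hd k).hasFDerivAt
  have h := ((hG (grad u x)).hasFDerivAt.comp x hgrad).fderiv
  have h' : pderiv1 (fun y => G (grad u y)) i x =
      fderiv ℝ G (grad u x) (fun k => pderiv1 (pderiv1 u k) i x) :=
    congrArg (fun L => L (Pi.single i 1)) h
  rw [h', pi_eq_sum_univ' (fun k => pderiv1 (pderiv1 u k) i x), map_sum]
  refine Finset.sum_congr rfl fun k _ => ?_
  rw [map_smul, smul_eq_mul, mul_comm]
  rfl

/-- The divergence of a periodic `C¹` vector field integrates to zero over the unit cube. -/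
lemma integral_dvg_eq_zero {V : (Fin n → ℝ) → (Fin n → ℝ)}
    (hV : ∀ i, ContDiff ℝ 1 fun x => V x i) (hp : ∀ i, ZPeriodic fun x => V x i) :
    ∫ x in Set.Icc (0 : Fin n → ℝ) 1, dvg V x = 0 := by
  cases n with
  | zero => simp [dvg]
  | succ m =>
    have hcont : Continuous (dvg V) := continuous_finsetSum _ fun i _ =>
      ((hV i).continuous_fderiv (by norm_num)).clm_apply continuous_const
    unfold dvg at hcont ⊢
    rw [integral_divergence_of_hasFDerivAt_off_countable' (0 : Fin (m + 1) → ℝ) 1 zero_le_one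
      (fun i x => V x i) (fun i x => fderiv ℝ (fun y => V y i) x) ∅ Set.countable_empty
      (fun i => (hV i).continuous.continuousOn)
      (fun x _ i => ((hV i).differentiable (by norm_num) x).hasFDerivAt)
      hcont.integrableOn_Icc]
    refine Finset.sum_eq_zero fun i _ => sub_eq_zero.2 (integral_congr_ae (.of_forall fun y => ?_))
    have h := hp i (i.insertNth 0 y) (Pi.single i 1)
    have hshift : (i.insertNth (0 : ℝ) y : Fin (m + 1) → ℝ) +
        (fun j => (((Pi.single i 1 : Fin (m + 1) → ℤ) j : ℤ) : ℝ)) = i.insertNth 1 y := by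
      funext j
      refine Fin.succAboveCases i ?_ (fun j => ?_) j <;> simp
    rw [hshift] at h
    exact h

/-- The product rule for the weighted field `e^{-f} D²u ∇g(∇u)`. -/
lemma dvg_exp_neg_mul_hess_grad {f u g : (Fin n → ℝ) → ℝ}
    (hf : ContDiff ℝ (⊤ : ℕ∞) f) (hu : ContDiff ℝ (⊤ : ℕ∞) u) (hg : ContDiff ℝ 2 g)
    (x : Fin n → ℝ) :
    dvg (fun y i => Real.exp (-f y) *
        ∑ j, pderiv1 g j (grad u y) * pderiv1 (pderiv1 u j) i y) x =
      dot (grad g (grad u x))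
          (grad (fun y => lap u y - dot (grad f y) (grad u y)) x) * Real.exp (-f x) +
        Matrix.trace (hess g (grad u x) * hess u x * hess u x) * Real.exp (-f x) +
        dot (grad g (grad u x)) ((hess f x).mulVec (grad u x)) * Real.exp (-f x) := by
  have hf1 := contDiff_top_pderiv1 hf
  have hu1 := contDiff_top_pderiv1 hu
  have hu2 (i j) := contDiff_top_pderiv1 (hu1 i) j
  have df : Differentiable ℝ f := hf.differentiable (by simp)
  have df1 (i) : Differentiable ℝ (pderiv1 f i) := (hf1 i).differentiable (by simp)
  have du1 (i) : Differentiable ℝ (pderiv1 u i) := (hu1 i).differentiable (by simp)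
  have du2 (i j) : Differentiable ℝ (pderiv1 (pderiv1 u i) j) :=
    (hu2 i j).differentiable (by simp)
  have dg1 (j) : Differentiable ℝ (pderiv1 g j) :=
    (contDiff_pderiv1 (m := 1) hg (by norm_num) j).differentiable (by norm_num)
  have dgu (j) : Differentiable ℝ fun y => pderiv1 g j (grad u y) :=
    (dg1 j).comp ((contDiff_grad hu).differentiable (by simp))
  have dprod (i j) : Differentiable ℝ
      fun y => pderiv1 g j (grad u y) * pderiv1 (pderiv1 u j) i y := (dgu j).mul (du2 j i)
  have dexp : Differentiable ℝ fun y => Real.exp (-f y) := df.neg.exp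
  have dfu (i) : Differentiable ℝ fun y => pderiv1 f i y * pderiv1 u i y := (df1 i).mul (du1 i)
  have h2 : (2 : WithTop ℕ∞) ≤ (⊤ : ℕ∞) := WithTop.coe_le_coe.2 le_top
  have hu_two : ContDiff ℝ 2 u := hu.of_le h2
  have comm3 (i j : Fin n) :
      pderiv1 (pderiv1 (pderiv1 u i) i) j = pderiv1 (pderiv1 (pderiv1 u j) i) i := by
    rw [pderiv1_comm ((hu1 i).of_le h2) i j, pderiv1_comm hu_two i j]
  have hfield (i : Fin n) : pderiv1 (fun y => Real.exp (-f y) *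
        ∑ j, pderiv1 g j (grad u y) * pderiv1 (pderiv1 u j) i y) i x =
      ∑ j, (pderiv1 g j (grad u x) * (pderiv1 (pderiv1 (pderiv1 u j) i) i x -
          pderiv1 f i x * pderiv1 (pderiv1 u j) i x) * Real.exp (-f x) +
        ∑ k, pderiv1 (pderiv1 g j) k (grad u x) * pderiv1 (pderiv1 u k) i x *
          pderiv1 (pderiv1 u j) i x * Real.exp (-f x)) := by
    rw [pderiv1_mul dexp (.fun_sum fun j _ => dprod i j), pderiv1_exp_neg df,
      pderiv1_sum _ (dprod i), Finset.mul_sum, Finset.mul_sum, ← Finset.sum_add_distrib]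
    refine Finset.sum_congr rfl fun j _ => ?_
    rw [pderiv1_mul (dgu j) (du2 j i), pderiv1_comp_grad (dg1 j) hu, ← Finset.sum_mul,
      ← Finset.sum_mul]
    ring
  have hdrift (j : Fin n) :
      grad (fun y => lap u y - dot (grad f y) (grad u y)) x j =
      ∑ i, (pderiv1 (pderiv1 (pderiv1 u j) i) i x -
        (pderiv1 f i x * pderiv1 (pderiv1 u j) i x +
          pderiv1 (pderiv1 f i) j x * pderiv1 u i x)) := by
    change pderiv1 (fun y => (∑ i, pderiv1 (pderiv1 u i) i y) -
      ∑ i, pderiv1 f i y * pderiv1 u i y) j x = _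
    rw [pderiv1_sub (.fun_sum fun i _ => du2 i i) (.fun_sum fun i _ => dfu i),
      pderiv1_sum _ (fun i => du2 i i), pderiv1_sum _ dfu,
      ← Finset.sum_sub_distrib]
    refine Finset.sum_congr rfl fun i _ => ?_
    rw [comm3, pderiv1_mul (df1 i) (du1 i), pderiv1_comm hu_two i j]
  have htrace : Matrix.trace (hess g (grad u x) * hess u x * hess u x) =
      ∑ i, ∑ j, ∑ k, pderiv1 (pderiv1 g j) k (grad u x) * pderiv1 (pderiv1 u k) i x *
          pderiv1 (pderiv1 u j) i x := by
    simp only [Matrix.trace, Matrix.diag, Matrix.mul_apply, hess, Matrix.of_apply,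
      Finset.sum_mul]
    rw [Finset.sum_comm]
    refine Finset.sum_congr rfl fun i _ => Finset.sum_congr rfl fun j _ =>
      Finset.sum_congr rfl fun k _ => ?_
    rw [pderiv1_comm hg j k, pderiv1_comm hu_two k i]
  unfold dvg
  change ∑ i, pderiv1 (fun y => Real.exp (-f y) *
        ∑ j, pderiv1 g j (grad u y) * pderiv1 (pderiv1 u j) i y) i x = _
  simp only [hfield, Finset.sum_add_distrib]
  rw [htrace, add_right_comm]
  congr 1
  · rw [Finset.sum_comm, ← add_mul]
    simp only [dot] at hdrift ⊢
    simp only [hdrift]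
    simp only [Matrix.mulVec, dotProduct, hess, Matrix.of_apply, grad,
      ← Finset.sum_add_distrib, Finset.sum_mul, Finset.mul_sum]
    refine Finset.sum_congr rfl fun j _ => Finset.sum_congr rfl fun i _ => ?_
    ring
  · simp only [Finset.sum_mul]

/-- the term `λ_viscous`:
`∫ ∇g(∇u)·∇(Δ_f u) dμ = −∫ tr(D²g(∇u) D²u D²u) dμ − ∫ ∇g(∇u)·(D²f ∇u) dμ`
for smooth periodic `f, u` and `g ∈ C²`, with `dμ = e^{-f} dx` on `[0,1]ⁿ`. -/
theorem lambda_viscous_identity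
    (f u g : (Fin n → ℝ) → ℝ)
    (hf : ContDiff ℝ (⊤ : ℕ∞) f) (hu : ContDiff ℝ (⊤ : ℕ∞) u)
    (hg : ContDiff ℝ 2 g)
    (hfp : ZPeriodic f) (hup : ZPeriodic u) :
    ∫ x in Set.Icc (0 : Fin n → ℝ) 1,
        dot (grad g (grad u x))
          (grad (fun y => lap u y - dot (grad f y) (grad u y)) x) * Real.exp (-f x) =
      -(∫ x in Set.Icc (0 : Fin n → ℝ) 1,
          Matrix.trace (hess g (grad u x) * hess u x * hess u x) * Real.exp (-f x))
      - ∫ x in Set.Icc (0 : Fin n → ℝ) 1,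
          dot (grad g (grad u x)) ((hess f x).mulVec (grad u x)) * Real.exp (-f x) := by
  have hgu (j : Fin n) : ContDiff ℝ 1 fun y => pderiv1 g j (grad u y) :=
    (contDiff_pderiv1 hg (by norm_num) j).comp
      ((contDiff_grad hu).of_le (by exact_mod_cast le_top))
  have hu2 (i j : Fin n) : ContDiff ℝ (⊤ : ℕ∞) (pderiv1 (pderiv1 u i) j) :=
    contDiff_top_pderiv1 (contDiff_top_pderiv1 hu i) j
  have hexp : Continuous fun x => Real.exp (-f x) := hf.continuous.neg.rexp
  have hw : ContDiff ℝ (⊤ : ℕ∞) fun y => lap u y - dot (grad f y) (grad u y) :=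
    (ContDiff.sum fun i _ => hu2 i i).sub
      (ContDiff.sum fun i _ => (contDiff_top_pderiv1 hf i).mul (contDiff_top_pderiv1 hu i))
  have hA : Continuous fun x => dot (grad g (grad u x))
      (grad (fun y => lap u y - dot (grad f y) (grad u y)) x) * Real.exp (-f x) :=
    (continuous_finsetSum _ fun i _ =>
      (hgu i).continuous.mul (contDiff_top_pderiv1 hw i).continuous).mul hexp
  have hhu : Continuous (hess u) :=
    continuous_matrix fun i j => (hu2 j i).continuous
  have hhf : Continuous (hess f) :=
    continuous_matrix fun i j => (contDiff_top_pderiv1 (contDiff_top_pderiv1 hf j) i).continuous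
  have hhg : Continuous fun x => hess g (grad u x) :=
    continuous_matrix fun i j =>
      (contDiff_pderiv1 (m := 0) (contDiff_pderiv1 (m := 1) hg (by norm_num) j)
        (by norm_num) i).continuous.comp (contDiff_grad hu).continuous
  have hB : Continuous fun x =>
      Matrix.trace (hess g (grad u x) * hess u x * hess u x) * Real.exp (-f x) :=
    ((hhg.matrix_mul hhu).matrix_mul hhu).matrix_trace.mul hexp
  have hC : Continuous fun x =>
      dot (grad g (grad u x)) ((hess f x).mulVec (grad u x)) * Real.exp (-f x) :=
    (continuous_finsetSum _ fun i _ => (hgu i).continuous.mul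
      ((continuous_apply i).comp (hhf.matrix_mulVec (contDiff_grad hu).continuous))).mul hexp
  have hV : ∀ i, ContDiff ℝ 1 fun y => Real.exp (-f y) *
      ∑ j, pderiv1 g j (grad u y) * pderiv1 (pderiv1 u j) i y := fun i =>
    (hf.of_le (by exact_mod_cast le_top)).neg.exp.mul
      (ContDiff.sum fun j _ => (hgu j).mul ((hu2 j i).of_le (by exact_mod_cast le_top)))
  have hp : ∀ i, ZPeriodic fun y => Real.exp (-f y) *
      ∑ j, pderiv1 g j (grad u y) * pderiv1 (pderiv1 u j) i y := by
    intro i x k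
    have hgrad : grad u (x + fun i => (k i : ℝ)) = grad u x :=
      funext fun j => zperiodic_pderiv1 hup j x k
    simp only [hfp x k, hgrad, zperiodic_pderiv1 (zperiodic_pderiv1 hup _) i x k]
  have h := integral_dvg_eq_zero hV hp
  simp only [dvg_exp_neg_mul_hess_grad hf hu hg] at h
  have hAB := hA.fun_add hB
  rw [integral_add hAB.integrableOn_Icc hC.integrableOn_Icc,
    integral_add hA.integrableOn_Icc hB.integrableOn_Icc] at h
  linarith
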